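/- The assignment φ_e* on the generators l_ρ of R_S maps the ideal I_S into I_{S₁∪{e₁}} ⊗ R_{S₂∪{e₂}} + R_{S₁∪{e₁}} ⊗ I_{S₂∪{e₂}}, and hence induces a well-defined homomorphism of k-algebras f_e* : H*_S → H*_{S₁∪{e₁}} ⊗ H*_{S₂∪{e₂}}, [l_ρ] ↦ [φ_e*(l_ρ)]; moreover f_e* is independent of the choice of allowed quadruple made in the definition of φ_e*(l_σ). -/

import Mathlib

open scoped Classical
noncomputable section

namespace EMO

/-- `σ` is an unordered 2-partition of the set `X`: two distinct nonempty disjoint parts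
whose union is `X`. -/
def IsTwoPartitionOn {γ : Type*} (X : Set γ) (σ : Set (Set γ)) : Prop :=
  ∃ A B : Set γ, σ = {A, B} ∧ A ≠ B ∧ A.Nonempty ∧ B.Nonempty ∧ Disjoint A B ∧ A ∪ B = X

/-- unordered 2-partition of the whole set. -/
def IsTwoPartition {γ : Type*} (σ : Set (Set γ)) : Prop :=
  IsTwoPartitionOn Set.univ σ

/-- `δ(σ,τ)`: the number of nonempty pairwise distinct sets among the intersections
`A ∩ B`, `A ∈ σ`, `B ∈ τ`, minus 2. -/
def delta {γ : Type*} (σ τ : Set (Set γ)) : ℤ :=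
  ({C : Set γ | C.Nonempty ∧ ∃ A ∈ σ, ∃ B ∈ τ, C = A ∩ B}.ncard : ℤ) - 2

/-- `a b σ c d` : the elements `a,b` lie in one part of `σ` and `c,d` in the other. -/
def SplitsPair {γ : Type*} (σ : Set (Set γ)) (a b c d : γ) : Prop :=
  ∃ A ∈ σ, ∃ B ∈ σ, A ≠ B ∧ a ∈ A ∧ b ∈ A ∧ c ∈ B ∧ d ∈ B

/-- a painted stable 2-partition w.r.t. the set `W` of white elements: each part
contains a white element and has at least two elements. -/
def PaintedStablePart {γ : Type*} (W : Set γ) (σ : Set (Set γ)) : Prop :=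
  IsTwoPartition σ ∧ ∀ A ∈ σ, (A ∩ W).Nonempty ∧ 2 ≤ A.ncard

/-- a good family of painted stable 2-partitions: pairwise `δ = 1`. -/
def GoodFamily {γ : Type*} (W : Set γ) (E : Set (Set (Set γ))) : Prop :=
  (∀ σ ∈ E, PaintedStablePart W σ) ∧ ∀ σ ∈ E, ∀ σ' ∈ E, σ ≠ σ' → delta σ σ' = 1

/-- an allowed quadruple: pairwise distinct, and each of the pairs
`{i,j}`, `{k,l}`, `{k,j}`, `{i,l}` contains a white element. -/
def Allowed {γ : Type*} (W : Set γ) (i j k l : γ) : Prop :=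
  i ≠ j ∧ i ≠ k ∧ i ≠ l ∧ j ≠ k ∧ j ≠ l ∧ k ≠ l ∧
  (i ∈ W ∨ j ∈ W) ∧ (k ∈ W ∨ l ∈ W) ∧ (k ∈ W ∨ j ∈ W) ∧ (i ∈ W ∨ l ∈ W)

/-- `ε(σ; i,j,k,l)`. -/
def eps {γ : Type*} (σ : Set (Set γ)) (i j k l : γ) : ℤ :=
  if SplitsPair σ i j k l then 1 else if SplitsPair σ k j i l then -1 else 0

/-- A tree whose tails are bijectively labeled by `γ`: a finite graph
(vertices, flags, incidence map, involution) whose geometric realization is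
connected and simply connected (edge count), together with a labeling of the tails. -/
structure LTree (γ : Type) where
  V : Type
  Fl : Type
  [finV : Finite V]
  [finF : Finite Fl]
  bd : Fl → V
  inv : Fl → Fl
  inv_inv : ∀ f, inv (inv f) = f
  label : γ → Fl
  label_fixed : ∀ s, inv (label s) = label s
  label_inj : Function.Injective label
  label_surj : ∀ f, inv f = f → ∃ s, label s = f
  conn : ∀ v w : V, Relation.ReflTransGen (fun a b => ∃ f, bd f = a ∧ bd (inv f) = b) v w
  tree_count : Nat.card {f : Fl // inv f ≠ f} + 2 = 2 * Nat.card V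

attribute [instance] LTree.finV LTree.finF

namespace LTree

variable {γ : Type} (τ : LTree γ)

/-- flags incident to a vertex. -/
def flagsAt (v : τ.V) : Set τ.Fl := {f | τ.bd f = v}

/-- adjacency avoiding the edge `{f, inv f}`. -/
def sideAdj (f : τ.Fl) (a b : τ.V) : Prop :=
  ∃ g, g ≠ f ∧ g ≠ τ.inv f ∧ τ.bd g = a ∧ τ.bd (τ.inv g) = b

/-- labels lying on the `f`-side of the edge `{f, inv f}`. -/
def flagSide (f : τ.Fl) : Set γ :=
  {s | Relation.ReflTransGen (τ.sideAdj f) (τ.bd (τ.label s)) (τ.bd f)}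

/-- the 2-partition `σ_e` of the labels determined by the edge `{f, inv f}`. -/
def flagPartition (f : τ.Fl) : Set (Set γ) := {τ.flagSide f, τ.flagSide (τ.inv f)}

/-- the family of 2-partitions of labels determined by the edges of `τ`. -/
def edgeFamily : Set (Set (Set γ)) := {σ | ∃ f, τ.inv f ≠ f ∧ τ.flagPartition f = σ}

/-- painted stability: every vertex carries at least three flags, and every
end vertex carries a white tail. -/
def PaintedStable (W : Set γ) : Prop :=
  (∀ v : τ.V, 3 ≤ Nat.card {f : τ.Fl // τ.bd f = v}) ∧
  (∀ v : τ.V, Nat.card {f : τ.Fl // τ.bd f = v ∧ τ.inv f ≠ f} ≤ 1 →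
    ∃ s ∈ W, τ.bd (τ.label s) = v)

/-- adjacency avoiding the vertex `v`. -/
def avoidAdj (v : τ.V) (a b : τ.V) : Prop :=
  a ≠ v ∧ b ≠ v ∧ ∃ g, τ.bd g = a ∧ τ.bd (τ.inv g) = b

/-- the labels carried by the branch of `τ` at `v` starting with the flag `φ`. -/
def branchLabels (v : τ.V) (φ : τ.Fl) : Set γ :=
  {s | τ.label s = φ ∨
    (τ.inv φ ≠ φ ∧ Relation.ReflTransGen (τ.avoidAdj v) (τ.bd (τ.inv φ)) (τ.bd (τ.label s)))}

/-- the 2-partition of labels induced by a 2-partition `α` of the flags at `v`. -/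
def inducedSPart (v : τ.V) (α : Set (Set τ.Fl)) : Set (Set γ) :=
  (fun A => ⋃ φ ∈ A, τ.branchLabels v φ) '' α

/-- painted stable 2-partitions of the set of flags at `v`. -/
def VertexParts (W : Set γ) (v : τ.V) : Set (Set (Set τ.Fl)) :=
  {α | IsTwoPartitionOn (τ.flagsAt v) α ∧ PaintedStablePart W (τ.inducedSPart v α)}

/-- an allowed quadruple of (pairwise distinct) flags at the vertex `v`: there are
labels on the corresponding branches forming an allowed quadruple. -/
def AllowedFlags (W : Set γ) (v : τ.V) (I J K L : τ.Fl) : Prop :=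
  I ∈ τ.flagsAt v ∧ J ∈ τ.flagsAt v ∧ K ∈ τ.flagsAt v ∧ L ∈ τ.flagsAt v ∧
  I ≠ J ∧ I ≠ K ∧ I ≠ L ∧ J ≠ K ∧ J ≠ L ∧ K ≠ L ∧
  ∃ i ∈ τ.branchLabels v I, ∃ j ∈ τ.branchLabels v J,
    ∃ a ∈ τ.branchLabels v K, ∃ b ∈ τ.branchLabels v L, Allowed W i j a b

end LTree

/-- an `S`-isomorphism of labeled trees (flags mapped in the reverse direction). -/
structure SIso {γ : Type} (τ τ' : LTree γ) where
  vmap : τ.V ≃ τ'.V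
  fmap : τ'.Fl ≃ τ.Fl
  bd_comp : ∀ f : τ'.Fl, τ'.bd f = vmap (τ.bd (fmap f))
  inv_comp : ∀ f : τ'.Fl, fmap (τ'.inv f) = τ.inv (fmap f)
  label_comp : ∀ s : γ, fmap (τ'.label s) = τ.label s

/-- a morphism `τ' → τ` of labeled trees contracting the edge `{e₁, inv e₁}` of `τ'`. -/
structure Contraction {γ : Type} (τ' τ : LTree γ) (e₁ : τ'.Fl) where
  cF : τ.Fl → τ'.Fl
  cV : τ'.V → τ.V
  cF_inj : Function.Injective cF
  cF_range : Set.range cF = {f : τ'.Fl | f ≠ e₁ ∧ f ≠ τ'.inv e₁}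
  cF_inv : ∀ f, cF (τ.inv f) = τ'.inv (cF f)
  cF_label : ∀ s : γ, cF (τ.label s) = τ'.label s
  cV_surj : Function.Surjective cV
  cV_bd : ∀ f : τ.Fl, cV (τ'.bd (cF f)) = τ.bd f
  cV_glue : cV (τ'.bd e₁) = cV (τ'.bd (τ'.inv e₁))
  cV_almost_inj : ∀ v w : τ'.V, cV v = cV w →
    v = w ∨ (({v, w} : Set τ'.V) = {τ'.bd e₁, τ'.bd (τ'.inv e₁)})

/-- the polynomial ring `R_S = k[l_σ]` on variables indexed by painted stable
2-partitions. -/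
abbrev PSP (γ : Type) (W : Set γ) := {σ : Set (Set γ) // PaintedStablePart W σ}

abbrev Rring (γ : Type) (W : Set γ) (k : Type) [CommRing k] := MvPolynomial (PSP γ W) k

/-- the variable `l_σ` (or `0` if `σ` is not painted stable). -/
def lvar (γ : Type) (W : Set γ) (k : Type) [CommRing k] (σ : Set (Set γ)) : Rring γ W k :=
  if h : PaintedStablePart W σ then MvPolynomial.X ⟨σ, h⟩ else 0

/-- the element `R_{ijkl} = Σ_σ ε(σ; i,j,k,l) l_σ`. -/
def Rquad (γ : Type) (W : Set γ) (k : Type) [CommRing k] (i j a b : γ) : Rring γ W k :=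
  ∑ᶠ σ : PSP γ W, eps σ.1 i j a b • MvPolynomial.X σ

/-- the ideal `I_S` generated by the `R_{ijkl}` (over allowed quadruples) and the
products `l_σ l_σ'` for crossing pairs `σ, σ'`. -/
def idealI (γ : Type) (W : Set γ) (k : Type) [CommRing k] : Ideal (Rring γ W k) :=
  Ideal.span
    ({p | ∃ i j a b : γ, Allowed W i j a b ∧ p = Rquad γ W k i j a b} ∪
     {p | ∃ σ σ' : PSP γ W, (∃ i j a b : γ, Allowed W i j a b ∧
        SplitsPair σ.1 i j a b ∧ SplitsPair σ'.1 a j i b) ∧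
        p = MvPolynomial.X σ * MvPolynomial.X σ'})

/-- the good monomial `∏_{σ ∈ E} l_σ` of a family `E` of 2-partitions. -/
def mFam (γ : Type) (W : Set γ) (k : Type) [CommRing k] (E : Set (Set (Set γ))) :
    Rring γ W k :=
  ∏ᶠ σ ∈ E, lvar γ W k σ

/-- the combinatorial cohomology ring `H*_S = R_S/I_S`. -/
abbrev HS (γ : Type) (W : Set γ) (k : Type) [CommRing k] := Rring γ W k ⧸ idealI γ W k

/-- good families of painted stable 2-partitions (= iso classes of painted stable trees). -/
abbrev GoodFam (γ : Type) (W : Set γ) := {E : Set (Set (Set γ)) // GoodFamily W E}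

/-- the free `k`-module `M_S` on the iso classes `μ(τ)` of painted stable `S`-trees,
encoded by their families of edge 2-partitions. -/
abbrev MS (γ : Type) (W : Set γ) (k : Type) [CommRing k] := GoodFam γ W →₀ k

/-- the basis element `μ(τ)` of `M_S` attached to the edge family `E` of `τ`. -/
def muE (γ : Type) (W : Set γ) (k : Type) [CommRing k] (E : Set (Set (Set γ))) : MS γ W k :=
  if h : GoodFamily W E then Finsupp.single ⟨E, h⟩ 1 else 0

/-- the standard relation `r(τ, v; I,J,K,L) = Σ_α ε(α; I,J,K,L) μ(τ(α))`. -/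
def stdRelH (γ : Type) (W : Set γ) (k : Type) [CommRing k]
    (τ : LTree γ) (v : τ.V) (I J K L : τ.Fl) : MS γ W k :=
  ∑ᶠ α ∈ τ.VertexParts W v, eps α I J K L • muE γ W k (τ.edgeFamily ∪ {τ.inducedSPart v α})

/-- the span `J_S` of the standard relations. -/
def JS (γ : Type) (W : Set γ) (k : Type) [CommRing k] : Submodule k (MS γ W k) :=
  Submodule.span k {x | ∃ τ : LTree γ, τ.PaintedStable W ∧ ∃ (v : τ.V) (I J K L : τ.Fl),
    τ.AllowedFlags W v I J K L ∧ x = stdRelH γ W k τ v I J K L}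

/-- the combinatorial homology `H_{*S} = M_S/J_S`. -/
abbrev HsLow (γ : Type) (W : Set γ) (k : Type) [CommRing k] := MS γ W k ⧸ JS γ W k

end EMO

namespace EMO

open TensorProduct

/-- the painting of `S₁ ∪ {e₁}`: the new element `e₁` (encoded as `none`) is white,
the old elements keep their color. -/
def optWhite {γ : Type} (W : Set γ) (S₁ : Set γ) : Set (Option ↥S₁) :=
  {o | o = none ∨ ∃ x : ↥S₁, o = some x ∧ ↑x ∈ W}

/-- a subset `P ⊆ S` transported to a subset of `S₁ ∪ {e₁}`. -/
def someSet {γ : Type} (S₁ : Set γ) (P : Set γ) : Set (Option ↥S₁) :=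
  {o | ∃ x : ↥S₁, o = some x ∧ ↑x ∈ P}

/-- The lift `φ_e*` on the generators `l_ρ` of `R_S`, for the one-edge `S`-tree `σ`
with parts `S₁, S₂` and halves `e₁, e₂`, depending on the choice of an allowed
quadruple `(i,j,a,b)` with `i,j ∈ S₁`, `a,b ∈ S₂`:

* `φ_e*(l_ρ) = 0` if `ρ` does not break `σ`;
* `φ_e*(l_ρ) = l_{ρ₁} ⊗ 1` if `ρ` breaks `σ` at the vertex of `S₁` (its part
  `P ⊆ S₁` yields the 2-partition `ρ₁ = {P, (S₁ ∖ P) ∪ {e₁}}` of `S₁ ∪ {e₁}`),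
  and symmetrically `1 ⊗ l_{ρ₂}`;
* `φ_e*(l_σ) = −Σ_{α : i,j | e₁} l_α ⊗ 1 − Σ_{β : a,b | e₂} 1 ⊗ l_β`. -/
def phiGen {γ : Type} [Finite γ] (W : Set γ) (S₁ S₂ : Set γ) (k : Type) [CommRing k]
    (i j : ↥S₁) (a b : ↥S₂) (ρ : PSP γ W) :
    Rring (Option ↥S₁) (optWhite W S₁) k ⊗[k] Rring (Option ↥S₂) (optWhite W S₂) k :=
  if ρ.1 = {S₁, S₂} then
    (-∑ᶠ α ∈ {α : Set (Set (Option ↥S₁)) | PaintedStablePart (optWhite W S₁) α ∧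
        SplitsPair α (some i) (some j) none none},
      lvar (Option ↥S₁) (optWhite W S₁) k α) ⊗ₜ[k] 1
    + 1 ⊗ₜ[k] (-∑ᶠ β ∈ {β : Set (Set (Option ↥S₂)) | PaintedStablePart (optWhite W S₂) β ∧
        SplitsPair β (some a) (some b) none none},
      lvar (Option ↥S₂) (optWhite W S₂) k β)
  else if h : ∃ P ∈ ρ.1, P ⊆ S₁ then
    (lvar (Option ↥S₁) (optWhite W S₁) k
      {someSet S₁ h.choose, insert none (someSet S₁ (S₁ \ h.choose))}) ⊗ₜ[k] 1
  else if h : ∃ P ∈ ρ.1, P ⊆ S₂ then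
    1 ⊗ₜ[k] (lvar (Option ↥S₂) (optWhite W S₂) k
      {someSet S₂ h.choose, insert none (someSet S₂ (S₂ \ h.choose))})
  else 0

/-- the ideal `I_{S₁∪{e₁}} ⊗ R_{S₂∪{e₂}} + R_{S₁∪{e₁}} ⊗ I_{S₂∪{e₂}}`. -/
def mixedIdeal {γ : Type} [Finite γ] (W : Set γ) (S₁ S₂ : Set γ) (k : Type) [CommRing k] :
    Ideal (Rring (Option ↥S₁) (optWhite W S₁) k ⊗[k] Rring (Option ↥S₂) (optWhite W S₂) k) :=
  (idealI (Option ↥S₁) (optWhite W S₁) k).map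
      (Algebra.TensorProduct.includeLeft (R := k) (S := k)) ⊔
  (idealI (Option ↥S₂) (optWhite W S₂) k).map
      (Algebra.TensorProduct.includeRight (R := k))

/-- the quotient map `R₁ ⊗ R₂ → H*₁ ⊗ H*₂`. -/
def quotTensor {γ : Type} [Finite γ] (W : Set γ) (S₁ S₂ : Set γ) (k : Type) [CommRing k] :
    Rring (Option ↥S₁) (optWhite W S₁) k ⊗[k] Rring (Option ↥S₂) (optWhite W S₂) k →ₐ[k]
      HS (Option ↥S₁) (optWhite W S₁) k ⊗[k] HS (Option ↥S₂) (optWhite W S₂) k :=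
  Algebra.TensorProduct.map
    (Ideal.Quotient.mkₐ k (idealI (Option ↥S₁) (optWhite W S₁) k))
    (Ideal.Quotient.mkₐ k (idealI (Option ↥S₂) (optWhite W S₂) k))

end EMO

namespace EMO

open TensorProduct

theorem IsTwoPartition.eq_compl {δ : Type*} {σ : Set (Set δ)} (h : IsTwoPartition σ)
    {A : Set δ} (hA : A ∈ σ) : σ = {A, Aᶜ} := by
  obtain ⟨B, C, rfl, -, -, -, hd, hu⟩ := h
  have hC : IsCompl B C := ⟨hd, codisjoint_iff.2 hu⟩
  rcases hA with rfl | rfl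
  · rw [hC.compl_eq]
  · rw [hC.symm.compl_eq, Set.pair_comm]

theorem isTwoPartition_pair_compl {δ : Type*} {A : Set δ} (h : A.Nonempty) (h' : Aᶜ.Nonempty) :
    IsTwoPartition ({A, Aᶜ} : Set (Set δ)) := by
  have : Nonempty δ := ⟨h.some⟩
  exact ⟨A, Aᶜ, rfl, ne_compl_self, h, h', disjoint_compl_right, Set.union_compl_self A⟩

theorem IsTwoPartition.exists_compl {δ : Type*} {σ : Set (Set δ)} (h : IsTwoPartition σ) :
    ∃ A : Set δ, σ = {A, Aᶜ} := by
  obtain ⟨A, B, hσ, -⟩ := id h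
  exact ⟨A, h.eq_compl (by simp [hσ])⟩

theorem splitsPair_pair_compl {δ : Type*} (A : Set δ) (a b c d : δ) :
    SplitsPair {A, Aᶜ} a b c d ↔
      (a ∈ A ∧ b ∈ A ∧ c ∉ A ∧ d ∉ A) ∨ (a ∉ A ∧ b ∉ A ∧ c ∈ A ∧ d ∈ A) := by
  constructor
  · rintro ⟨B, hB, C, hC, hne, h⟩
    rcases hB with rfl | rfl <;> rcases hC with rfl | rfl
    · exact absurd rfl hne
    · exact Or.inl h
    · exact Or.inr h
    · exact absurd rfl hne
  · have : Nonempty δ := ⟨a⟩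
    have hne : A ≠ Aᶜ := ne_compl_self
    rintro (h | h)
    · exact ⟨A, by simp, Aᶜ, by simp, hne, h⟩
    · exact ⟨Aᶜ, by simp, A, by simp, hne.symm, h⟩

/-- Two 2-partitions with disjoint parts do not cross. -/
theorem not_crossing_of_disjoint {δ : Type*} {P Q : Set δ} (h : Disjoint P Q) {p q r s : δ}
    (h₁ : SplitsPair {P, Pᶜ} p q r s) (h₂ : SplitsPair {Q, Qᶜ} r q p s) : False := by
  rw [splitsPair_pair_compl] at h₁ h₂
  have this : ∀ x ∈ P, x ∉ Q := fun _ hx => Set.disjoint_left.1 h hx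
  have hp := this p
  have hq := this q
  have hr := this r
  have hs := this s
  tauto

theorem paintedStablePart_pair_compl {δ : Type} {W A : Set δ} :
    PaintedStablePart W {A, Aᶜ} ↔
      ((A ∩ W).Nonempty ∧ 2 ≤ A.ncard) ∧ (Aᶜ ∩ W).Nonempty ∧ 2 ≤ Aᶜ.ncard := by
  constructor
  · exact fun h => ⟨h.2 A (by simp), h.2 Aᶜ (by simp)⟩
  · rintro ⟨h₁, h₂⟩
    refine ⟨isTwoPartition_pair_compl h₁.1.left h₂.1.left, ?_⟩
    rintro B (rfl | rfl)
    exacts [h₁, h₂]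

section Linear

variable {δ : Type} {W : Set δ} {k : Type} [CommRing k]

theorem eps_pair_compl (A : Set δ) (a b c d : δ) :
    eps {A, Aᶜ} a b c d =
      if (a ∈ A ∧ b ∈ A ∧ c ∉ A ∧ d ∉ A) ∨ (a ∉ A ∧ b ∉ A ∧ c ∈ A ∧ d ∈ A) then 1
      else if (c ∈ A ∧ b ∈ A ∧ a ∉ A ∧ d ∉ A) ∨ (c ∉ A ∧ b ∉ A ∧ a ∈ A ∧ d ∈ A) then -1
      else 0 := by
  simp only [eps, splitsPair_pair_compl]

theorem Rquad_mem {i j a b : δ} (h : Allowed W i j a b) : Rquad δ W k i j a b ∈ idealI δ W k :=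
  Ideal.subset_span (Or.inl ⟨i, j, a, b, h, rfl⟩)

theorem finsum_lvar_eq_Rquad (i j e : δ) :
    ∑ᶠ α ∈ {α : Set (Set δ) | PaintedStablePart W α ∧ SplitsPair α i j e e}, lvar δ W k α =
      Rquad δ W k i j e e := by
  have h : Rquad δ W k i j e e = ∑ᶠ α : ↥{α : Set (Set δ) | PaintedStablePart W α},
      (if SplitsPair α.1 i j e e then lvar δ W k α.1 else 0) := by
    refine finsum_congr fun σ => ?_
    obtain ⟨σ, hσ⟩ := σ
    obtain ⟨A, rfl⟩ := hσ.1.exists_compl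
    simp only [lvar, dif_pos (show PaintedStablePart W _ from hσ), eps_pair_compl,
      splitsPair_pair_compl]
    by_cases hi : i ∈ A <;> by_cases hj : j ∈ A <;> by_cases he : e ∈ A <;> simp [*]
  rw [h, finsum_set_coe_eq_finsum_mem {α : Set (Set δ) | PaintedStablePart W α}
    (f := fun α => if SplitsPair α i j e e then lvar δ W k α else 0)]
  refine finsum_congr fun α => ?_
  by_cases h₁ : PaintedStablePart W α <;> by_cases h₂ : SplitsPair α i j e e <;> simp [h₁, h₂]

variable [Finite δ]

theorem Rquad_sub_Rquad (i j m e : δ) :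
    Rquad δ W k i j e e - Rquad δ W k m j e e = Rquad δ W k i j m e := by
  unfold Rquad
  rw [← finsum_sub_distrib (Set.toFinite _) (Set.toFinite _)]
  refine finsum_congr fun σ => ?_
  rw [← sub_smul]
  congr 1
  obtain ⟨A, hA⟩ := σ.2.1.exists_compl
  simp only [hA, eps_pair_compl]
  by_cases hi : i ∈ A <;> by_cases hj : j ∈ A <;> by_cases hm : m ∈ A <;> by_cases he : e ∈ A <;>
    simp [*]

theorem Rquad_congr {i j a b i' j' a' b' : δ} (c : ℤ)
    (h : ∀ A : Set δ, eps {A, Aᶜ} i j a b = c * eps {A, Aᶜ} i' j' a' b') :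
    Rquad δ W k i j a b = c • Rquad δ W k i' j' a' b' := by
  unfold Rquad
  rw [smul_finsum' c (Set.toFinite _)]
  refine finsum_congr fun σ => ?_
  obtain ⟨A, hA⟩ := σ.2.1.exists_compl
  rw [hA, h, mul_smul]

theorem Rquad_eq_zero {i j a b : δ} (h : ∀ A : Set δ, eps {A, Aᶜ} i j a b = 0) :
    Rquad δ W k i j a b = 0 := by
  simpa using Rquad_congr (W := W) (k := k) (i' := i) (j' := j) (a' := a) (b' := b) 0
    fun A => by simp [h]

theorem Rquad_swap (i j e : δ) : Rquad δ W k i j e e = Rquad δ W k j i e e := by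
  simpa using Rquad_congr (W := W) (k := k) 1 fun A => by
    simp only [eps_pair_compl]
    by_cases hi : i ∈ A <;> by_cases hj : j ∈ A <;> by_cases he : e ∈ A <;> simp [*]

theorem Rquad_sub_mem_of_common {i j m e : δ} (he : e ∈ W) (hi : i ≠ e) (hj : j ≠ e) (hm : m ≠ e)
    (hij : i ≠ j) (hmj : m ≠ j) (h₁ : i ∈ W ∨ j ∈ W) (h₂ : m ∈ W ∨ j ∈ W) :
    Rquad δ W k i j e e - Rquad δ W k m j e e ∈ idealI δ W k := by
  by_cases him : i = m
  · simp [him]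
  · rw [Rquad_sub_Rquad]
    exact Rquad_mem ⟨hij, him, hi, hmj.symm, hj, hm, h₁, Or.inr he, h₂, Or.inr he⟩

/-- Modulo `I_S`, the element `Σ_{α : i, j | e} l_α` does not depend on the pair `i, j`. -/
theorem Rquad_sub_mem {i j i' j' e : δ} (he : e ∈ W) (hi : i ≠ e) (hj : j ≠ e)
    (hi' : i' ≠ e) (hj' : j' ≠ e) (hij : i ≠ j) (hij' : i' ≠ j')
    (h₁ : i ∈ W ∨ j ∈ W) (h₂ : i' ∈ W ∨ j' ∈ W) :
    Rquad δ W k i j e e - Rquad δ W k i' j' e e ∈ idealI δ W k := by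
  wlog hjW : j ∈ W generalizing i j
  · rw [Rquad_swap i j]
    exact this hj hi hij.symm h₁.symm (h₁.resolve_right hjW)
  wlog hjW' : j' ∈ W generalizing i' j'
  · rw [Rquad_swap i' j']
    exact this hj' hi' hij'.symm h₂.symm (h₂.resolve_right hjW')
  by_cases hjj : j = j'
  · subst hjj
    exact Rquad_sub_mem_of_common he hi hj hi' hij hij' h₁ h₂
  · have e₁ := Rquad_sub_mem_of_common (k := k) he hi hj hj' hij (Ne.symm hjj) h₁ (Or.inr hjW)
    have e₂ := Rquad_sub_mem_of_common (k := k) he hj hj' hi' hjj hij' (Or.inr hjW') h₂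
    rw [Rquad_swap j' j] at e₁
    simpa using add_mem e₁ e₂

theorem Rquad_eq_zero_of_eq {a b c d : δ} (h : a = c ∨ b = d) : Rquad δ W k a b c d = 0 := by
  refine Rquad_eq_zero fun A => ?_
  rw [eps_pair_compl, if_neg, if_neg]
  all_goals rcases h with rfl | rfl <;> tauto

theorem Rquad_flip (x y e : δ) : Rquad δ W k e e x y = Rquad δ W k x y e e := by
  simpa using Rquad_congr (W := W) (k := k) 1 fun A => by
    simp only [eps_pair_compl]
    by_cases hx : x ∈ A <;> by_cases hy : y ∈ A <;> by_cases he : e ∈ A <;> simp [*]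

theorem Rquad_inner (x y e : δ) : Rquad δ W k e x y e = - Rquad δ W k y x e e := by
  simpa using Rquad_congr (W := W) (k := k) (-1) fun A => by
    simp only [eps_pair_compl]
    by_cases hx : x ∈ A <;> by_cases hy : y ∈ A <;> by_cases he : e ∈ A <;> simp [*]

theorem Rquad_outer (x y e : δ) : Rquad δ W k x e e y = - Rquad δ W k x y e e := by
  simpa using Rquad_congr (W := W) (k := k) (-1) fun A => by
    simp only [eps_pair_compl]
    by_cases hx : x ∈ A <;> by_cases hy : y ∈ A <;> by_cases he : e ∈ A <;> simp [*]

end Linear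

section Collapse

variable {γ : Type} {W S : Set γ}

/-- The map `γ → S ∪ {e}` collapsing the complement of `S` to `e`. -/
def collapse (S : Set γ) (x : γ) : Option ↥S := if h : x ∈ S then some ⟨x, h⟩ else none

theorem collapse_of_mem {x : γ} (h : x ∈ S) : collapse S x = some ⟨x, h⟩ := dif_pos h

theorem collapse_of_notMem {x : γ} (h : x ∉ S) : collapse S x = none := dif_neg h

theorem collapse_surjective (h : Sᶜ.Nonempty) : Function.Surjective (collapse S) := by
  rintro (_ | x)
  · obtain ⟨x, hx⟩ := h
    exact ⟨x, collapse_of_notMem hx⟩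
  · exact ⟨x, collapse_of_mem x.2⟩

theorem collapse_mem_optWhite (x : γ) : collapse S x ∈ optWhite W S ↔ x ∈ W ∨ x ∉ S := by
  by_cases h : x ∈ S <;> simp [collapse, optWhite, h]

theorem some_mem_optWhite {x : ↥S} : some x ∈ optWhite W S ↔ (x : γ) ∈ W := by
  constructor
  · rintro (h | ⟨y, h, hy⟩)
    · cases h
    · rwa [Option.some_injective _ h]
  · exact fun h => Or.inr ⟨x, rfl, h⟩

theorem none_mem_optWhite : none ∈ optWhite W S := Or.inl rfl

theorem collapse_ne {x y : γ} (h : x ≠ y) (h' : x ∈ S ∨ y ∈ S) : collapse S x ≠ collapse S y := by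
  by_cases hx : x ∈ S <;> by_cases hy : y ∈ S <;> simp_all [collapse]

theorem allowed_collapse {p q r s : γ} (h : Allowed W p q r s) (h₁ : p ∈ S ∨ q ∈ S)
    (h₂ : p ∈ S ∨ r ∈ S) (h₃ : p ∈ S ∨ s ∈ S) (h₄ : q ∈ S ∨ r ∈ S) (h₅ : q ∈ S ∨ s ∈ S)
    (h₆ : r ∈ S ∨ s ∈ S) :
    Allowed (optWhite W S) (collapse S p) (collapse S q) (collapse S r) (collapse S s) := by
  obtain ⟨n₁, n₂, n₃, n₄, n₅, n₆, w₁, w₂, w₃, w₄⟩ := h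
  refine ⟨collapse_ne n₁ h₁, collapse_ne n₂ h₂, collapse_ne n₃ h₃, collapse_ne n₄ h₄,
    collapse_ne n₅ h₅, collapse_ne n₆ h₆, ?_⟩
  simp only [collapse_mem_optWhite]
  exact ⟨w₁.imp Or.inl Or.inl, w₂.imp Or.inl Or.inl, w₃.imp Or.inl Or.inl, w₄.imp Or.inl Or.inl⟩

theorem preimage_collapse_someSet {P : Set γ} (hP : P ⊆ S) :
    collapse S ⁻¹' someSet S P = P := by
  ext x
  by_cases h : x ∈ S
  · simp [collapse, someSet, h]
  · simpa [collapse, someSet, h] using fun hx => h (hP hx)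

theorem insert_none_someSet (P : Set γ) :
    insert none (someSet S (S \ P)) = (someSet S P)ᶜ := by
  ext (_ | x) <;> simp [someSet]

theorem exists_someSet_eq {A : Set (Option ↥S)} (h : none ∉ A) :
    ∃ P ⊆ S, A = someSet S P := by
  refine ⟨{x | ∃ h : x ∈ S, some ⟨x, h⟩ ∈ A}, fun x hx => hx.1, ?_⟩
  ext (_ | x)
  · simp [someSet, h]
  · exact ⟨fun hx => ⟨x, rfl, x.2, hx⟩, by rintro ⟨_, ⟨⟩, _, hx⟩; exact hx⟩

/-- The 2-partition of `γ` induced by a 2-partition of `S ∪ {e}`. -/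
def pullback (S : Set γ) (α : Set (Set (Option ↥S))) : Set (Set γ) :=
  (collapse S ⁻¹' ·) '' α

theorem pullback_pair_compl (A : Set (Option ↥S)) :
    pullback S {A, Aᶜ} = {collapse S ⁻¹' A, (collapse S ⁻¹' A)ᶜ} := by
  simp [pullback, Set.image_pair]

theorem pullback_someSet {P : Set γ} (hP : P ⊆ S) :
    pullback S {someSet S P, (someSet S P)ᶜ} = {P, Pᶜ} := by
  rw [pullback_pair_compl, preimage_collapse_someSet hP]

theorem pullback_injective (h : Sᶜ.Nonempty) : Function.Injective (pullback S) :=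
  Set.image_injective.2 (Set.preimage_injective.2 (collapse_surjective h))

theorem splitsPair_pullback {α : Set (Set (Option ↥S))} (hα : IsTwoPartition α) (p q r s : γ) :
    SplitsPair (pullback S α) p q r s ↔
      SplitsPair α (collapse S p) (collapse S q) (collapse S r) (collapse S s) := by
  obtain ⟨A, rfl⟩ := hα.exists_compl
  rw [pullback_pair_compl, splitsPair_pair_compl, splitsPair_pair_compl]
  rfl

theorem eps_pullback {α : Set (Set (Option ↥S))} (hα : IsTwoPartition α) (p q r s : γ) :
    eps (pullback S α) p q r s =
      eps α (collapse S p) (collapse S q) (collapse S r) (collapse S s) := by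
  simp only [eps, splitsPair_pullback hα]

theorem ncard_someSet [Finite γ] {P : Set γ} (hP : P ⊆ S) : (someSet S P).ncard = P.ncard := by
  have h : Subtype.val '' (some ⁻¹' someSet S P) = P := by
    ext x
    simpa [someSet] using @hP x
  have h' : someSet S P = some '' (some ⁻¹' someSet S P) := by
    ext (_ | x) <;> simp [someSet]
  rw [h', Set.ncard_image_of_injective _ (Option.some_injective _),
    ← Set.ncard_image_of_injective _ Subtype.val_injective, h]

theorem someSet_inter_optWhite_nonempty {P : Set γ} (hP : P ⊆ S) :
    (someSet S P ∩ optWhite W S).Nonempty ↔ (P ∩ W).Nonempty := by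
  constructor
  · rintro ⟨_, ⟨x, rfl, hx⟩, hW⟩
    exact ⟨x, hx, some_mem_optWhite.1 hW⟩
  · rintro ⟨x, hx, hW⟩
    exact ⟨some ⟨x, hP hx⟩, ⟨_, rfl, hx⟩, some_mem_optWhite.2 hW⟩

/-- The only part of `{P, Pᶜ}` contained in `S` is `P`. -/
theorem eq_of_mem_pair_compl {P Q : Set γ} (hP : P ⊆ S) (hS : Sᶜ.Nonempty)
    (hQ : Q ∈ ({P, Pᶜ} : Set (Set γ))) (hQS : Q ⊆ S) : Q = P := by
  rcases hQ with rfl | rfl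
  · rfl
  · obtain ⟨x, hx⟩ := hS
    exact absurd (hQS fun hxP => hx (hP hxP)) hx

variable [Finite γ]

theorem paintedStablePart_someSet {P : Set γ} (hP : P ⊆ S) :
    PaintedStablePart (optWhite W S) {someSet S P, (someSet S P)ᶜ} ↔
      ((P ∩ W).Nonempty ∧ 2 ≤ P.ncard) ∧ P ≠ S := by
  rw [paintedStablePart_pair_compl, someSet_inter_optWhite_nonempty hP, ncard_someSet hP]
  refine and_congr_right fun _ => ⟨?_, fun hne => 
    ⟨⟨none, by simp [someSet], none_mem_optWhite⟩, ?_⟩⟩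
  · rintro ⟨-, h⟩ rfl
    have : (someSet P P)ᶜ = {none} := by
      ext (_ | x) <;> simp [someSet]
    simp [this] at h
  · obtain ⟨x, hxS, hxP⟩ := Set.exists_of_ssubset (hP.ssubset_of_ne hne)
    refine (Set.one_lt_ncard (Set.toFinite _)).2
      ⟨none, by simp [someSet], some ⟨x, hxS⟩, by simp [someSet, hxP], by simp⟩

theorem PaintedStablePart.exists_someSet {α : Set (Set (Option ↥S))}
    (hα : PaintedStablePart (optWhite W S) α) :
    ∃ P ⊆ S, α = {someSet S P, (someSet S P)ᶜ} ∧ (P ∩ W).Nonempty ∧ 2 ≤ P.ncard ∧ P ≠ S := by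
  obtain ⟨A, hA⟩ := hα.1.exists_compl
  have key : ∀ B : Set (Option ↥S), none ∉ B → α = {B, Bᶜ} →
      ∃ P ⊆ S, α = {someSet S P, (someSet S P)ᶜ} ∧ (P ∩ W).Nonempty ∧ 2 ≤ P.ncard ∧ P ≠ S := by
    intro B hB hαB
    obtain ⟨P, hP, rfl⟩ := exists_someSet_eq hB
    obtain ⟨⟨h₁, h₂⟩, h₃⟩ := (paintedStablePart_someSet hP).1 (hαB ▸ hα)
    exact ⟨P, hP, hαB, h₁, h₂, h₃⟩
  by_cases h : none ∈ A
  · exact key Aᶜ (by simpa using h) (by rw [hA, compl_compl, Set.pair_comm])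
  · exact key A h hA

theorem paintedStablePart_pullback (hS : (Sᶜ ∩ W).Nonempty ∧ 2 ≤ Sᶜ.ncard)
    {α : Set (Set (Option ↥S))} (hα : PaintedStablePart (optWhite W S) α) :
    PaintedStablePart W (pullback S α) := by
  obtain ⟨P, hP, rfl, h₁, h₂, -⟩ := hα.exists_someSet
  have hc : Sᶜ ⊆ Pᶜ := Set.compl_subset_compl.2 hP
  rw [pullback_someSet hP, paintedStablePart_pair_compl]
  exact ⟨⟨h₁, h₂⟩, hS.1.mono (Set.inter_subset_inter_left _ hc),
    hS.2.trans (Set.ncard_le_ncard hc)⟩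

theorem exists_pullback_eq {ρ : Set (Set γ)} (hρ : PaintedStablePart W ρ) {P : Set γ}
    (hP : P ∈ ρ) (hPS : P ⊆ S) (hne : P ≠ S) :
    ∃ α, PaintedStablePart (optWhite W S) α ∧ ρ = pullback S α :=
  ⟨{someSet S P, (someSet S P)ᶜ}, (paintedStablePart_someSet hPS).2 ⟨hρ.2 P hP, hne⟩, by
    rw [pullback_someSet hPS, hρ.1.eq_compl hP]⟩

theorem notMem_pullback {α : Set (Set (Option ↥S))} (hS : Sᶜ.Nonempty)
    (hα : PaintedStablePart (optWhite W S) α) : S ∉ pullback S α := by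
  obtain ⟨P, hP, rfl, -, -, hne⟩ := hα.exists_someSet
  rw [pullback_someSet hP]
  exact fun h => hne (eq_of_mem_pair_compl hP hS h subset_rfl).symm

theorem Rquad_collapse_sub_mem {k : Type} [CommRing k] (i j : ↥S) (hij : (i : γ) ≠ j)
    (hw : (i : γ) ∈ W ∨ (j : γ) ∈ W) {p q r s : γ} (h : Allowed W p q r s) :
    Rquad (Option ↥S) (optWhite W S) k (collapse S p) (collapse S q) (collapse S r) (collapse S s)
      - eps {S, Sᶜ} p q r s • Rquad (Option ↥S) (optWhite W S) k (some i) (some j) none none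
      ∈ idealI (Option ↥S) (optWhite W S) k := by
  have hall := allowed_collapse (S := S) h
  obtain ⟨h₁, h₂, h₃, h₄, h₅, h₆, w₁, w₂, w₃, w₄⟩ := h
  have key : ∀ x y : γ, ∀ (hx : x ∈ S) (hy : y ∈ S), x ≠ y → (x ∈ W ∨ y ∈ W) →
      Rquad (Option ↥S) (optWhite W S) k (some ⟨x, hx⟩) (some ⟨y, hy⟩) none none
        - Rquad (Option ↥S) (optWhite W S) k (some i) (some j) none none
        ∈ idealI (Option ↥S) (optWhite W S) k := by
    intro x y hx hy hxy hxyw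
    refine Rquad_sub_mem none_mem_optWhite (by simp) (by simp) (by simp) (by simp)
      (by simpa using hxy) (by simpa [Subtype.ext_iff] using hij) ?_ ?_
    · simpa only [some_mem_optWhite] using hxyw
    · simpa only [some_mem_optWhite] using hw
  have zero : ∀ {a b c d : Option ↥S}, (a = c ∨ b = d) →
      Rquad (Option ↥S) (optWhite W S) k a b c d ∈ idealI (Option ↥S) (optWhite W S) k := by
    intro a b c d h
    rw [Rquad_eq_zero_of_eq h]
    exact zero_mem _
  by_cases hp : p ∈ S <;> by_cases hq : q ∈ S <;> by_cases hr : r ∈ S <;> by_cases hs : s ∈ S <;>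
    simp only [eps_pair_compl, collapse_of_mem, collapse_of_notMem, hp, hq, hr, hs,
      not_true_eq_false, not_false_eq_true, and_self, and_true, and_false, or_false, or_self, or_true,
      if_true, if_false, zero_smul, one_smul,
      sub_zero, neg_smul, forall_const] at hall ⊢
  · exact Rquad_mem hall
  · exact Rquad_mem hall
  · exact Rquad_mem hall
  · exact key p q hp hq h₁ w₁
  · exact Rquad_mem hall
  · exact zero (Or.inr rfl)
  · rw [Rquad_outer, ← neg_sub']
    exact neg_mem (key p s hp hs h₃ w₄)
  · exact zero (Or.inr rfl)
  · exact Rquad_mem hall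
  · rw [Rquad_inner, ← neg_sub']
    exact neg_mem (key r q hr hq h₄.symm w₃)
  · exact zero (Or.inl rfl)
  · exact zero (Or.inl rfl)
  · rw [Rquad_flip]
    exact key r s hr hs h₆ w₂
  · exact zero (Or.inr rfl)
  · exact zero (Or.inl rfl)
  · exact zero (Or.inl rfl)

end Collapse

section Phi

variable {γ : Type} {W S₁ S₂ : Set γ} {k : Type} [CommRing k]

theorem PaintedStablePart.isCompl (hσ : PaintedStablePart W {S₁, S₂}) : IsCompl S₁ S₂ := by
  have h := hσ.1.eq_compl (A := S₁) (by simp)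
  have h₂ : S₂ ∈ ({S₁, S₁ᶜ} : Set (Set γ)) := by simp [← h]
  rcases h₂ with h₂ | h₂
  · have : S₁ᶜ ∈ ({S₁, S₂} : Set (Set γ)) := by simp [h]
    have hc : S₁ᶜ = S₁ := by simpa [h₂] using this
    obtain ⟨x, -⟩ := (hσ.2 S₁ (by simp)).1
    have : Nonempty γ := ⟨x⟩
    exact absurd hc compl_ne_self
  · rw [Set.mem_singleton_iff] at h₂
    exact h₂ ▸ isCompl_compl

theorem X_mul_X_mem_of_crossing_pullback {S : Set γ} {p q r s : γ} (h : Allowed W p q r s)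
    (α α' : PSP (Option ↥S) (optWhite W S)) (h₁ : SplitsPair (pullback S α.1) p q r s)
    (h₂ : SplitsPair (pullback S α'.1) r q p s) :
    (MvPolynomial.X α * MvPolynomial.X α' : Rring (Option ↥S) (optWhite W S) k) ∈
      idealI (Option ↥S) (optWhite W S) k := by
  rw [splitsPair_pullback α.2.1] at h₁
  rw [splitsPair_pullback α'.2.1] at h₂
  have key : ∀ x y, collapse S x ≠ collapse S y → x ∈ S ∨ y ∈ S := by
    intro x y hxy
    by_contra! hc
    exact hxy (by rw [collapse_of_notMem hc.1, collapse_of_notMem hc.2])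
  refine Ideal.subset_span (Or.inr ⟨α, α', ⟨_, _, _, _, allowed_collapse h ?_ ?_ ?_ ?_ ?_ ?_,
    h₁, h₂⟩, rfl⟩)
  all_goals
    refine key _ _ fun heq => ?_
    obtain ⟨A, hA⟩ := α.2.1.exists_compl
    obtain ⟨B, hB⟩ := α'.2.1.exists_compl
    rw [hA, splitsPair_pair_compl] at h₁
    rw [hB, splitsPair_pair_compl] at h₂
    simp only [heq] at h₁ h₂
    tauto

variable [Finite γ]

theorem phiGen_edge (i j : ↥S₁) (a b : ↥S₂) {ρ : PSP γ W} (hρ : ρ.1 = {S₁, S₂}) :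
    phiGen W S₁ S₂ k i j a b ρ =
      (-Rquad (Option ↥S₁) (optWhite W S₁) k (some i) (some j) none none) ⊗ₜ[k] 1
      + 1 ⊗ₜ[k] (-Rquad (Option ↥S₂) (optWhite W S₂) k (some a) (some b) none none) := by
  rw [phiGen, if_pos hρ, finsum_lvar_eq_Rquad, finsum_lvar_eq_Rquad]

theorem phiGen_left (hσ : PaintedStablePart W {S₁, S₂}) (i j : ↥S₁) (a b : ↥S₂) {ρ : PSP γ W}
    (α : PSP (Option ↥S₁) (optWhite W S₁)) (hρ : ρ.1 = pullback S₁ α.1) :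
    phiGen W S₁ S₂ k i j a b ρ = (MvPolynomial.X α) ⊗ₜ[k] 1 := by
  obtain ⟨α, hα⟩ := α
  have hc := hσ.isCompl.compl_eq
  have hne : S₁ᶜ.Nonempty := hc ▸ (hσ.2 S₂ (by simp)).1.left
  have h₁ : ρ.1 ≠ {S₁, S₂} := fun h => notMem_pullback hne hα (hρ ▸ h ▸ by simp)
  obtain ⟨P, hP, rfl, -⟩ := hα.exists_someSet
  rw [pullback_someSet hP] at hρ
  have h₂ : ∃ Q ∈ ρ.1, Q ⊆ S₁ := ⟨P, by simp [hρ], hP⟩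
  have h₃ : h₂.choose = P :=
    eq_of_mem_pair_compl hP hne (hρ ▸ h₂.choose_spec.1) h₂.choose_spec.2
  rw [phiGen, if_neg h₁, dif_pos h₂, h₃, insert_none_someSet, lvar, dif_pos hα]

theorem phiGen_right (hσ : PaintedStablePart W {S₁, S₂}) (i j : ↥S₁) (a b : ↥S₂) {ρ : PSP γ W}
    (β : PSP (Option ↥S₂) (optWhite W S₂)) (hρ : ρ.1 = pullback S₂ β.1) :
    phiGen W S₁ S₂ k i j a b ρ = 1 ⊗ₜ[k] (MvPolynomial.X β) := by
  obtain ⟨β, hβ⟩ := β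
  have hc := hσ.isCompl.symm.compl_eq
  have hne : S₂ᶜ.Nonempty := hc ▸ (hσ.2 S₁ (by simp)).1.left
  have h₁ : ρ.1 ≠ {S₁, S₂} := fun h => notMem_pullback hne hβ (hρ ▸ h ▸ by simp)
  obtain ⟨P, hP, rfl, hPW, -, hPS⟩ := hβ.exists_someSet
  rw [pullback_someSet hP] at hρ
  have h₂ : ¬ ∃ Q ∈ ρ.1, Q ⊆ S₁ := by
    rintro ⟨Q, hQ, hQS⟩
    rw [hρ] at hQ
    rcases hQ with rfl | rfl
    · obtain ⟨x, hx, -⟩ := hPW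
      exact Set.disjoint_left.1 hσ.isCompl.disjoint (hQS hx) (hP hx)
    · refine hPS (hP.antisymm ?_)
      rw [← compl_compl P, ← hσ.isCompl.compl_eq]
      exact Set.compl_subset_compl.2 hQS
  have h₃ : ∃ Q ∈ ρ.1, Q ⊆ S₂ := ⟨P, by simp [hρ], hP⟩
  have h₄ : h₃.choose = P :=
    eq_of_mem_pair_compl hP hne (hρ ▸ h₃.choose_spec.1) h₃.choose_spec.2
  rw [phiGen, if_neg h₁, dif_neg h₂, dif_pos h₃, h₄, insert_none_someSet, lvar, dif_pos hβ]

theorem phiGen_cases (hσ : PaintedStablePart W {S₁, S₂}) (i j : ↥S₁) (a b : ↥S₂) (ρ : PSP γ W) :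
    ρ.1 = {S₁, S₂} ∨
    (∃ α : PSP (Option ↥S₁) (optWhite W S₁), ρ.1 = pullback S₁ α.1) ∨
    (∃ β : PSP (Option ↥S₂) (optWhite W S₂), ρ.1 = pullback S₂ β.1) ∨
    phiGen W S₁ S₂ k i j a b ρ = 0 := by
  by_cases h : ρ.1 = {S₁, S₂}
  · exact Or.inl h
  refine Or.inr ?_
  by_cases h₁ : ∃ P ∈ ρ.1, P ⊆ S₁
  · obtain ⟨P, hP, hPS⟩ := h₁
    obtain ⟨α, hα, hρ⟩ := exists_pullback_eq ρ.2 hP hPS fun hne => h <| by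
      rw [ρ.2.1.eq_compl hP, hne, hσ.isCompl.compl_eq]
    exact Or.inl ⟨⟨α, hα⟩, hρ⟩
  by_cases h₂ : ∃ P ∈ ρ.1, P ⊆ S₂
  · obtain ⟨P, hP, hPS⟩ := h₂
    obtain ⟨β, hβ, hρ⟩ := exists_pullback_eq ρ.2 hP hPS fun hne => h <| by
      rw [ρ.2.1.eq_compl hP, hne, hσ.isCompl.symm.compl_eq, Set.pair_comm]
    exact Or.inr (Or.inl ⟨⟨β, hβ⟩, hρ⟩)
  · exact Or.inr (Or.inr (by rw [phiGen, if_neg h, dif_neg h₁, dif_neg h₂]))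

theorem tmul_one_mem_mixedIdeal {x : Rring (Option ↥S₁) (optWhite W S₁) k}
    (hx : x ∈ idealI (Option ↥S₁) (optWhite W S₁) k) : x ⊗ₜ[k] 1 ∈ mixedIdeal W S₁ S₂ k :=
  Ideal.mem_sup_left (Ideal.mem_map_of_mem
    (Algebra.TensorProduct.includeLeft (R := k) (S := k)) hx)

theorem one_tmul_mem_mixedIdeal {y : Rring (Option ↥S₂) (optWhite W S₂) k}
    (hy : y ∈ idealI (Option ↥S₂) (optWhite W S₂) k) : 1 ⊗ₜ[k] y ∈ mixedIdeal W S₁ S₂ k :=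
  Ideal.mem_sup_right (Ideal.mem_map_of_mem
    (Algebra.TensorProduct.includeRight (R := k)) hy)

theorem quotTensor_eq_zero {x} (hx : x ∈ mixedIdeal W S₁ S₂ k) :
    quotTensor W S₁ S₂ k x = 0 := by
  suffices h : mixedIdeal W S₁ S₂ k ≤ RingHom.ker (quotTensor W S₁ S₂ k) from h hx
  refine sup_le (Ideal.map_le_iff_le_comap.2 fun y hy => ?_)
    (Ideal.map_le_iff_le_comap.2 fun y hy => ?_)
  · simp [quotTensor, RingHom.mem_ker, Ideal.Quotient.eq_zero_iff_mem.2 hy]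
  · simp [quotTensor, RingHom.mem_ker, Ideal.Quotient.eq_zero_iff_mem.2 hy]

theorem aeval_phiGen_Rquad (hσ : PaintedStablePart W {S₁, S₂}) (i j : ↥S₁) (a b : ↥S₂)
    (p q r s : γ) :
    MvPolynomial.aeval (phiGen W S₁ S₂ k i j a b) (Rquad γ W k p q r s) =
      (Rquad (Option ↥S₁) (optWhite W S₁) k
          (collapse S₁ p) (collapse S₁ q) (collapse S₁ r) (collapse S₁ s)
        - eps {S₁, S₁ᶜ} p q r s •
          Rquad (Option ↥S₁) (optWhite W S₁) k (some i) (some j) none none) ⊗ₜ[k] 1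
      + 1 ⊗ₜ[k] (Rquad (Option ↥S₂) (optWhite W S₂) k
          (collapse S₂ p) (collapse S₂ q) (collapse S₂ r) (collapse S₂ s)
        - eps {S₂, S₂ᶜ} p q r s •
          Rquad (Option ↥S₂) (optWhite W S₂) k (some a) (some b) none none) := by
  have hc₁ := hσ.isCompl.compl_eq
  have hc₂ := hσ.isCompl.symm.compl_eq
  have hS₁ := hσ.2 S₂ (by simp)
  have hS₂ := hσ.2 S₁ (by simp)
  have hε₁ : eps {S₁, S₁ᶜ} p q r s = eps {S₁, S₂} p q r s := by rw [hc₁]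
  have hε₂ : eps {S₂, S₂ᶜ} p q r s = eps {S₁, S₂} p q r s := by rw [hc₂, Set.pair_comm]
  rw [hε₁, hε₂]
  rw [← hc₁] at hS₁
  rw [← hc₂] at hS₂
  let e : Unit ⊕ (PSP (Option ↥S₁) (optWhite W S₁) ⊕ PSP (Option ↥S₂) (optWhite W S₂)) → PSP γ W :=
    Sum.elim (fun _ => ⟨{S₁, S₂}, hσ⟩)
      (Sum.elim (fun α => ⟨pullback S₁ α.1, paintedStablePart_pullback hS₁ α.2⟩)
        (fun β => ⟨pullback S₂ β.1, paintedStablePart_pullback hS₂ β.2⟩))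
  have ne₁ : ∀ α : PSP (Option ↥S₁) (optWhite W S₁), pullback S₁ α.1 ≠ {S₁, S₂} :=
    fun α h => notMem_pullback hS₁.1.left α.2 (h ▸ by simp)
  have ne₂ : ∀ β : PSP (Option ↥S₂) (optWhite W S₂), pullback S₂ β.1 ≠ {S₁, S₂} :=
    fun β h => notMem_pullback hS₂.1.left β.2 (h ▸ by simp)
  have ne₃ : ∀ (α : PSP (Option ↥S₁) (optWhite W S₁)) (β : PSP (Option ↥S₂) (optWhite W S₂)),
      pullback S₁ α.1 ≠ pullback S₂ β.1 := by
    rintro ⟨α, hα⟩ ⟨β, hβ⟩ h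
    obtain ⟨P, hP, rfl, hPW, -⟩ := hα.exists_someSet
    obtain ⟨Q, hQ, rfl, -, -, hQS⟩ := hβ.exists_someSet
    simp only [pullback_someSet hP, pullback_someSet hQ] at h
    have hPQ : P ∈ ({Q, Qᶜ} : Set (Set γ)) := h ▸ by simp
    rcases hPQ with rfl | rfl
    · obtain ⟨x, hx, -⟩ := hPW
      exact Set.disjoint_left.1 hσ.isCompl.disjoint (hP hx) (hQ hx)
    · refine hQS (hQ.antisymm ?_)
      rw [← compl_compl Q, ← hc₁]
      exact Set.compl_subset_compl.2 hP
  have he : Function.Injective e := by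
    refine Function.Injective.sumElim (fun _ _ _ => rfl) (Function.Injective.sumElim ?_ ?_ ?_) ?_
    · exact fun α α' h => Subtype.ext (pullback_injective hS₁.1.left (Subtype.ext_iff.1 h))
    · exact fun β β' h => Subtype.ext (pullback_injective hS₂.1.left (Subtype.ext_iff.1 h))
    · exact fun α β h => ne₃ α β (Subtype.ext_iff.1 h)
    · rintro - (α | β) h
      exacts [ne₁ α (Subtype.ext_iff.1 h).symm, ne₂ β (Subtype.ext_iff.1 h).symm]
  have := Fintype.ofFinite (PSP γ W)
  have := Fintype.ofFinite (PSP (Option ↥S₁) (optWhite W S₁))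
  have := Fintype.ofFinite (PSP (Option ↥S₂) (optWhite W S₂))
  have hsum : MvPolynomial.aeval (phiGen W S₁ S₂ k i j a b) (Rquad γ W k p q r s) =
      ∑ x, eps (e x).1 p q r s • phiGen W S₁ S₂ k i j a b (e x) := by
    simp only [Rquad, finsum_eq_sum_of_fintype, map_sum, map_zsmul, MvPolynomial.aeval_X]
    refine (Fintype.sum_of_injective e he _ _ (fun ρ hρ => ?_) fun _ => rfl).symm
    rcases phiGen_cases (k := k) hσ i j a b ρ with h | ⟨α, h⟩ | ⟨β, h⟩ | h
    · exact absurd ⟨Sum.inl (), Subtype.ext h.symm⟩ hρ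
    · exact absurd ⟨Sum.inr (Sum.inl α), Subtype.ext h.symm⟩ hρ
    · exact absurd ⟨Sum.inr (Sum.inr β), Subtype.ext h.symm⟩ hρ
    · rw [h, smul_zero]
  have hl : ∀ α, eps (e (Sum.inr (Sum.inl α))).1 p q r s •
      phiGen W S₁ S₂ k i j a b (e (Sum.inr (Sum.inl α))) =
      (eps α.1 (collapse S₁ p) (collapse S₁ q) (collapse S₁ r) (collapse S₁ s) •
        MvPolynomial.X α) ⊗ₜ[k] 1 := fun α => by
    rw [phiGen_left hσ i j a b α rfl, TensorProduct.smul_tmul', ← eps_pullback α.2.1]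
    rfl
  have hr : ∀ β, eps (e (Sum.inr (Sum.inr β))).1 p q r s •
      phiGen W S₁ S₂ k i j a b (e (Sum.inr (Sum.inr β))) =
      1 ⊗ₜ[k] (eps β.1 (collapse S₂ p) (collapse S₂ q) (collapse S₂ r) (collapse S₂ s) •
        MvPolynomial.X β) := fun β => by
    rw [phiGen_right hσ i j a b β rfl, TensorProduct.tmul_smul, ← eps_pullback β.2.1]
    rfl
  rw [hsum, Fintype.sum_sum_type, Fintype.sum_sum_type]
  simp only [hl, hr, ← TensorProduct.sum_tmul, ← TensorProduct.tmul_sum]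
  simp only [← finsum_eq_sum_of_fintype]
  simp only [finsum_unique, phiGen_edge i j a b (ρ := e (Sum.inl default)) rfl, smul_add,
    TensorProduct.sub_tmul, TensorProduct.tmul_sub, TensorProduct.neg_tmul, TensorProduct.tmul_neg,
    smul_neg, ← TensorProduct.smul_tmul', TensorProduct.tmul_smul]
  simp only [Rquad]
  simp only [e, Sum.elim_inl]
  abel

theorem aeval_phiGen_Rquad_mem (hσ : PaintedStablePart W {S₁, S₂}) {i j : ↥S₁} {a b : ↥S₂}
    (hq : Allowed W ↑i ↑j ↑a ↑b) {p q r s : γ} (h : Allowed W p q r s) :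
    MvPolynomial.aeval (phiGen W S₁ S₂ k i j a b) (Rquad γ W k p q r s) ∈
      mixedIdeal W S₁ S₂ k := by
  obtain ⟨hij, -, -, -, -, hab, hw₁, hw₂, -, -⟩ := hq
  rw [aeval_phiGen_Rquad hσ]
  exact add_mem (tmul_one_mem_mixedIdeal (Rquad_collapse_sub_mem i j hij hw₁ h))
    (one_tmul_mem_mixedIdeal (Rquad_collapse_sub_mem a b hab hw₂ h))

theorem phiGen_mul_phiGen_mem (hσ : PaintedStablePart W {S₁, S₂}) (i j : ↥S₁) (a b : ↥S₂)
    {p q r s : γ} (h : Allowed W p q r s) {ρ ρ' : PSP γ W} (h₁ : SplitsPair ρ.1 p q r s)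
    (h₂ : SplitsPair ρ'.1 r q p s) :
    phiGen W S₁ S₂ k i j a b ρ * phiGen W S₁ S₂ k i j a b ρ' ∈ mixedIdeal W S₁ S₂ k := by
  have hd := hσ.isCompl.disjoint
  have hσ₁ : ({S₁, S₂} : Set (Set γ)) = {S₁, S₁ᶜ} := by rw [hσ.isCompl.compl_eq]
  have hσ₂ : ({S₁, S₂} : Set (Set γ)) = {S₂, S₂ᶜ} := by
    rw [hσ.isCompl.symm.compl_eq, Set.pair_comm]
  have left : ∀ α : PSP (Option ↥S₁) (optWhite W S₁),
      ∃ P ⊆ S₁, pullback S₁ α.1 = {P, Pᶜ} := fun α => by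
    obtain ⟨P, hP, hα, -⟩ := α.2.exists_someSet
    exact ⟨P, hP, by rw [hα, pullback_someSet hP]⟩
  have right : ∀ β : PSP (Option ↥S₂) (optWhite W S₂),
      ∃ Q ⊆ S₂, pullback S₂ β.1 = {Q, Qᶜ} := fun β => by
    obtain ⟨P, hP, hβ, -⟩ := β.2.exists_someSet
    exact ⟨P, hP, by rw [hβ, pullback_someSet hP]⟩
  have contra : ∀ {P Q : Set γ}, P ⊆ S₁ → Q ⊆ S₂ →
      (ρ.1 = {P, Pᶜ} ∧ ρ'.1 = {Q, Qᶜ} ∨ ρ.1 = {Q, Qᶜ} ∧ ρ'.1 = {P, Pᶜ}) → False := by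
    rintro P Q hP hQ (⟨hρ, hρ'⟩ | ⟨hρ, hρ'⟩) <;> rw [hρ] at h₁ <;> rw [hρ'] at h₂
    · exact not_crossing_of_disjoint (hd.mono hP hQ) h₁ h₂
    · exact not_crossing_of_disjoint (hd.mono hP hQ).symm h₁ h₂
  rcases phiGen_cases (k := k) hσ i j a b ρ with hρ | ⟨α, hρ⟩ | ⟨β, hρ⟩ | hρ
  rotate_left 3
  · rw [hρ, zero_mul]
    exact zero_mem _
  all_goals rcases phiGen_cases (k := k) hσ i j a b ρ' with hρ' | ⟨α', hρ'⟩ | ⟨β', hρ'⟩ | hρ'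
  rotate_left 3
  · rw [hρ', mul_zero]
    exact zero_mem _
  rotate_left 3
  · rw [hρ', mul_zero]
    exact zero_mem _
  rotate_left 3
  · rw [hρ', mul_zero]
    exact zero_mem _
  · exact (contra subset_rfl subset_rfl (Or.inl ⟨hρ.trans hσ₁, hρ'.trans hσ₂⟩)).elim
  · obtain ⟨P, hP, hα⟩ := left α'
    exact (contra hP subset_rfl (Or.inr ⟨hρ.trans hσ₂, hρ'.trans hα⟩)).elim
  · obtain ⟨Q, hQ, hβ⟩ := right β'
    exact (contra subset_rfl hQ (Or.inl ⟨hρ.trans hσ₁, hρ'.trans hβ⟩)).elim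
  · obtain ⟨P, hP, hα⟩ := left α
    exact (contra hP subset_rfl (Or.inl ⟨hρ.trans hα, hρ'.trans hσ₂⟩)).elim
  · rw [phiGen_left hσ i j a b α hρ, phiGen_left hσ i j a b α' hρ',
      Algebra.TensorProduct.tmul_mul_tmul, one_mul]
    exact tmul_one_mem_mixedIdeal
      (X_mul_X_mem_of_crossing_pullback h α α' (hρ ▸ h₁) (hρ' ▸ h₂))
  · obtain ⟨P, hP, hα⟩ := left α
    obtain ⟨Q, hQ, hβ⟩ := right β'
    exact (contra hP hQ (Or.inl ⟨hρ.trans hα, hρ'.trans hβ⟩)).elim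
  · obtain ⟨Q, hQ, hβ⟩ := right β
    exact (contra subset_rfl hQ (Or.inr ⟨hρ.trans hβ, hρ'.trans hσ₁⟩)).elim
  · obtain ⟨P, hP, hα⟩ := left α'
    obtain ⟨Q, hQ, hβ⟩ := right β
    exact (contra hP hQ (Or.inr ⟨hρ.trans hβ, hρ'.trans hα⟩)).elim
  · rw [phiGen_right hσ i j a b β hρ, phiGen_right hσ i j a b β' hρ',
      Algebra.TensorProduct.tmul_mul_tmul, one_mul]
    exact one_tmul_mem_mixedIdeal
      (X_mul_X_mem_of_crossing_pullback h β β' (hρ ▸ h₁) (hρ' ▸ h₂))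

theorem aeval_phiGen_mem (hσ : PaintedStablePart W {S₁, S₂}) {i j : ↥S₁} {a b : ↥S₂}
    (hq : Allowed W ↑i ↑j ↑a ↑b) {x : Rring γ W k} (hx : x ∈ idealI γ W k) :
    MvPolynomial.aeval (phiGen W S₁ S₂ k i j a b) x ∈ mixedIdeal W S₁ S₂ k := by
  suffices h : idealI γ W k ≤ (mixedIdeal W S₁ S₂ k).comap
      (MvPolynomial.aeval (phiGen W S₁ S₂ k i j a b)) from h hx
  refine Ideal.span_le.2 ?_
  rintro _ (⟨p, q, r, s, h, rfl⟩ | ⟨ρ, ρ', ⟨p, q, r, s, h, h₁, h₂⟩, rfl⟩)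
  · exact aeval_phiGen_Rquad_mem hσ hq h
  · simpa using phiGen_mul_phiGen_mem hσ i j a b h h₁ h₂

theorem phiGen_sub_phiGen_mem {i j i' j' : ↥S₁} {a b a' b' : ↥S₂} (hq : Allowed W ↑i ↑j ↑a ↑b)
    (hq' : Allowed W ↑i' ↑j' ↑a' ↑b') (ρ : PSP γ W) :
    phiGen W S₁ S₂ k i' j' a' b' ρ - phiGen W S₁ S₂ k i j a b ρ ∈ mixedIdeal W S₁ S₂ k := by
  by_cases h : ρ.1 = {S₁, S₂}
  · rw [phiGen_edge _ _ _ _ h, phiGen_edge _ _ _ _ h, add_sub_add_comm, ← TensorProduct.sub_tmul,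
      ← TensorProduct.tmul_sub]
    have key : ∀ {S : Set γ} {x y x' y' : ↥S}, (x : γ) ≠ y → (x' : γ) ≠ y' →
        ((x : γ) ∈ W ∨ (y : γ) ∈ W) → ((x' : γ) ∈ W ∨ (y' : γ) ∈ W) →
        - Rquad (Option ↥S) (optWhite W S) k (some x') (some y') none none -
          - Rquad (Option ↥S) (optWhite W S) k (some x) (some y) none none ∈
          idealI (Option ↥S) (optWhite W S) k := by
      intro S x y x' y' hxy hxy' hw hw'
      rw [neg_sub_neg]
      exact Rquad_sub_mem none_mem_optWhite (by simp) (by simp) (by simp) (by simp)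
        (by simpa [Subtype.ext_iff] using hxy) (by simpa [Subtype.ext_iff] using hxy')
        (by simpa only [some_mem_optWhite] using hw) (by simpa only [some_mem_optWhite] using hw')
    obtain ⟨hij, -, -, -, -, hab, hw₁, hw₂, -, -⟩ := hq
    obtain ⟨hij', -, -, -, -, hab', hw₁', hw₂', -, -⟩ := hq'
    exact add_mem (tmul_one_mem_mixedIdeal (key hij hij' hw₁ hw₁'))
      (one_tmul_mem_mixedIdeal (key hab hab' hw₂ hw₂'))
  · simp only [phiGen, if_neg h, sub_self, zero_mem]

end Phi

/-- **Lemma 3.2.1(a).** `φ_e*` maps `I_S` into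
`I₁ ⊗ R₂ + R₁ ⊗ I₂`, hence induces a well-defined `k`-algebra homomorphism
`f_e* : H*_S → H*_{S₁∪{e₁}} ⊗ H*_{S₂∪{e₂}}`, `[l_ρ] ↦ [φ_e*(l_ρ)]`, which is
independent of the choice of allowed quadruple. -/
theorem phi_induces_fstar {γ : Type} [Finite γ] (W : Set γ) (k : Type) [CommRing k]
    (h3 : 3 ≤ Nat.card γ) (hW : 2 ≤ W.ncard)
    (S₁ S₂ : Set γ) (hσ : PaintedStablePart W {S₁, S₂})
    (i j : ↥S₁) (a b : ↥S₂) (hq : Allowed W ↑i ↑j ↑a ↑b) :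
    (∀ p ∈ idealI γ W k,
      MvPolynomial.aeval (phiGen W S₁ S₂ k i j a b) p ∈ mixedIdeal W S₁ S₂ k) ∧
    (∃! fstar : HS γ W k →ₐ[k]
        HS (Option ↥S₁) (optWhite W S₁) k ⊗[k] HS (Option ↥S₂) (optWhite W S₂) k,
      ∀ p : Rring γ W k,
        fstar (Ideal.Quotient.mk (idealI γ W k) p) =
          quotTensor W S₁ S₂ k (MvPolynomial.aeval (phiGen W S₁ S₂ k i j a b) p)) ∧
    (∀ (i' j' : ↥S₁) (a' b' : ↥S₂), Allowed W ↑i' ↑j' ↑a' ↑b' →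
      (quotTensor W S₁ S₂ k).comp
          (MvPolynomial.aeval (phiGen W S₁ S₂ k i' j' a' b') :
            Rring γ W k →ₐ[k] _) =
        (quotTensor W S₁ S₂ k).comp
          (MvPolynomial.aeval (phiGen W S₁ S₂ k i j a b))) := by
  have hmem : ∀ p ∈ idealI γ W k,
      MvPolynomial.aeval (phiGen W S₁ S₂ k i j a b) p ∈ mixedIdeal W S₁ S₂ k :=
    fun p hp => aeval_phiGen_mem hσ hq hp
  refine ⟨hmem, ?_, fun i' j' a' b' hq' => ?_⟩
  · refine ⟨Ideal.Quotient.liftₐ (idealI γ W k)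
      ((quotTensor W S₁ S₂ k).comp (MvPolynomial.aeval (phiGen W S₁ S₂ k i j a b)))
      fun p hp => quotTensor_eq_zero (hmem p hp), fun p => rfl, fun f hf => ?_⟩
    refine AlgHom.ext fun x => ?_
    obtain ⟨p, rfl⟩ := Ideal.Quotient.mk_surjective x
    exact hf p
  · refine MvPolynomial.algHom_ext fun ρ => ?_
    have h := quotTensor_eq_zero (phiGen_sub_phiGen_mem (k := k) hq hq' ρ)
    rw [map_sub, sub_eq_zero] at h
    simpa using h

end EMO
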